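/- The map ε ↦ g_ε(X;Y) is concave on [0,∞): for all 0 ≤ ε₁ < ε₂ < ε₃, g_{ε₂}(X;Y) ≥ ((ε₂−ε₁)/(ε₃−ε₁))·g_{ε₃}(X;Y) + ((ε₃−ε₂)/(ε₃−ε₁))·g_{ε₁}(X;Y). -/

import Mathlib

open scoped BigOperators

noncomputable section

namespace RatePrivacy

variable {α β γ : Type*}

/-- `p` is a probability mass function on a finite alphabet. -/
def IsPMF [Fintype α] (p : α → ℝ) : Prop := (∀ a, 0 ≤ p a) ∧ ∑ a, p a = 1

/-- Shannon entropy (in bits) of the distribution `p`. -/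
def ent [Fintype α] (p : α → ℝ) : ℝ := ∑ a, -(p a * Real.logb 2 (p a))

/-- First marginal of a joint distribution. -/
def margA [Fintype α] [Fintype β] (p : α × β → ℝ) : α → ℝ := fun a => ∑ b, p (a, b)

/-- Second marginal of a joint distribution. -/
def margB [Fintype α] [Fintype β] (p : α × β → ℝ) : β → ℝ := fun b => ∑ a, p (a, b)

/-- Mutual information (in bits) of a joint distribution `p`:
`I(A;B) = H(A) + H(B) - H(A,B)`. -/
def mi [Fintype α] [Fintype β] (p : α × β → ℝ) : ℝ :=
  ent (margA p) + ent (margB p) - ent p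

/-- `q` is a (row-stochastic) channel. -/
def IsChannel [Fintype γ] (q : β → γ → ℝ) : Prop :=
  (∀ y z, 0 ≤ q y z) ∧ ∀ y, ∑ z, q y z = 1

/-- Joint distribution of `(X, Z)` when `Z` is obtained from `Y` through the channel `q`
(so that `X — Y — Z` is a Markov chain). -/
def jointXZ [Fintype α] [Fintype β] [Fintype γ] (p : α × β → ℝ) (q : β → γ → ℝ) :
    α × γ → ℝ := fun xz => ∑ y, p (xz.1, y) * q y xz.2

/-- Joint distribution of `(Y, Z)` when `Z` is obtained from `Y` through the channel `q`. -/
def jointYZ [Fintype α] [Fintype β] [Fintype γ] (p : α × β → ℝ) (q : β → γ → ℝ) :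
    β × γ → ℝ := fun yz => margB p yz.1 * q yz.1 yz.2

/-- Achievable rates `I(Y;Z)` over all privacy filters `Z` (on finite alphabets, wlog `Fin n`)
with `X — Y — Z` Markov and `I(X;Z) ≤ ε`. -/
def gSet [Fintype α] [Fintype β] (p : α × β → ℝ) (ε : ℝ) : Set ℝ :=
  { r | ∃ (n : ℕ) (q : β → Fin n → ℝ), IsChannel q ∧
        mi (jointXZ p q) ≤ ε ∧ r = mi (jointYZ p q) }

/-- The rate-privacy function `g_ε(X;Y)` (privacy measured by mutual information). -/
def g [Fintype α] [Fintype β] (p : α × β → ℝ) (ε : ℝ) : ℝ := sSup (gSet p ε)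

/-- Values `E[f(A) g(B)]` over all zero-mean unit-variance `f, g`, used to define
the Hirschfeld–Gebelein–Rényi maximal correlation. -/
def corrSet [Fintype α] [Fintype β] (p : α × β → ℝ) : Set ℝ :=
  { r | ∃ (f : α → ℝ) (g : β → ℝ),
      (∑ a, margA p a * f a = 0) ∧ (∑ b, margB p b * g b = 0) ∧
      (∑ a, margA p a * (f a) ^ 2 = 1) ∧ (∑ b, margB p b * (g b) ^ 2 = 1) ∧
      r = ∑ x : α × β, p x * (f x.1 * g x.2) }

/-- Maximal correlation `ρ_m(A;B)` (equal to `0` when the constraint set is empty,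
since `sSup ∅ = 0` in `ℝ`). -/
def rhoM [Fintype α] [Fintype β] (p : α × β → ℝ) : ℝ := sSup (corrSet p)

/-- Achievable rates with maximal-correlation privacy constraint `ρ_m²(X;Z) ≤ ε`. -/
def ghSet [Fintype α] [Fintype β] (p : α × β → ℝ) (ε : ℝ) : Set ℝ :=
  { r | ∃ (n : ℕ) (q : β → Fin n → ℝ), IsChannel q ∧
        (rhoM (jointXZ p q)) ^ 2 ≤ ε ∧ r = mi (jointYZ p q) }

/-- The rate-privacy function `ĝ_ε(X;Y)` (privacy measured by squared maximal correlation). -/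
def gh [Fintype α] [Fintype β] (p : α × β → ℝ) (ε : ℝ) : ℝ := sSup (ghSet p ε)

/-- The Kullback–Leibler divergence (in bits) `D(P_{X|Y}(·|y) ‖ P_X)`. -/
def Dxy [Fintype α] [Fintype β] (p : α × β → ℝ) (y : β) : ℝ :=
  ∑ x, (p (x, y) / margB p y) * Real.logb 2 ((p (x, y) / margB p y) / margA p x)

/-- The negative conditional entropy `H(B) - H(A,B) = -H(A|B)` of a joint distribution. -/
def negCondEnt [Fintype α] [Fintype β] (p : α × β → ℝ) : ℝ := ent (margB p) - ent p

theorem mi_eq_add_negCondEnt [Fintype α] [Fintype β] (p : α × β → ℝ) :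
    mi p = ent (margA p) + negCondEnt p := by
  unfold mi negCondEnt; ring

theorem negCondEnt_eq_sum [Fintype α] [Fintype β] (p : α × β → ℝ) :
    negCondEnt p = ∑ b, ∑ a,
      (p (a, b) * Real.logb 2 (p (a, b)) - p (a, b) * Real.logb 2 (margB p b)) := by
  have h : ent p = ∑ b, ∑ a, -(p (a, b) * Real.logb 2 (p (a, b))) := by
    unfold ent
    rw [Fintype.sum_prod_type, Finset.sum_comm]
  unfold negCondEnt
  rw [h, ent, ← Finset.sum_sub_distrib]
  refine Finset.sum_congr rfl fun b _ => ?_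
  rw [Finset.sum_sub_distrib, ← Finset.sum_mul, Finset.sum_neg_distrib]
  simp only [margB]
  ring

theorem negCondEnt_nonpos [Fintype α] [Fintype β] (p : α × β → ℝ) (hp : ∀ x, 0 ≤ p x) :
    negCondEnt p ≤ 0 := by
  rw [negCondEnt_eq_sum]
  refine Finset.sum_nonpos fun b _ => Finset.sum_nonpos fun a _ => ?_
  rcases (hp (a, b)).eq_or_lt with h | h
  · simp [← h]
  · have hle : p (a, b) ≤ margB p b :=
      Finset.single_le_sum (f := fun a => p (a, b)) (fun i _ => hp (i, b)) (Finset.mem_univ a)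
    have hlog := Real.logb_le_logb_of_le (by norm_num : (1 : ℝ) < 2) h hle
    exact sub_nonpos.2 (mul_le_mul_of_nonneg_left hlog h.le)

theorem negCondEnt_smul [Fintype α] [Fintype β] (p : α × β → ℝ) (hp : ∀ x, 0 ≤ p x) (c : ℝ) :
    negCondEnt (fun x => c * p x) = c * negCondEnt p := by
  rcases eq_or_ne c 0 with rfl | hc
  · simp [negCondEnt_eq_sum]
  rw [negCondEnt_eq_sum, negCondEnt_eq_sum, Finset.mul_sum]
  refine Finset.sum_congr rfl fun b _ => ?_
  rw [Finset.mul_sum]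
  refine Finset.sum_congr rfl fun a _ => ?_
  have hm : margB (fun x => c * p x) b = c * margB p b := by
    simp only [margB, Finset.mul_sum]
  rcases (hp (a, b)).eq_or_lt with h | h
  · simp [← h]
  · have hle : p (a, b) ≤ margB p b :=
      Finset.single_le_sum (f := fun a => p (a, b)) (fun i _ => hp (i, b)) (Finset.mem_univ a)
    rw [hm, Real.logb_mul hc h.ne', Real.logb_mul hc (h.trans_le hle).ne']
    ring

theorem negCondEnt_fin_add [Fintype α] {m n : ℕ} (p : α × Fin (m + n) → ℝ) :
    negCondEnt p = negCondEnt (fun x : α × Fin m => p (x.1, Fin.castAdd n x.2)) +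
      negCondEnt (fun x : α × Fin n => p (x.1, Fin.natAdd m x.2)) := by
  simp only [negCondEnt_eq_sum, Fin.sum_univ_add, margB]

theorem margA_jointXZ [Fintype α] [Fintype β] [Fintype γ] (p : α × β → ℝ) {q : β → γ → ℝ}
    (hq : IsChannel q) : margA (jointXZ p q) = margA p := by
  funext x
  simp only [margA, jointXZ]
  rw [Finset.sum_comm]
  simp only [← Finset.mul_sum, hq.2, mul_one]

theorem margA_jointYZ [Fintype α] [Fintype β] [Fintype γ] (p : α × β → ℝ) {q : β → γ → ℝ}
    (hq : IsChannel q) : margA (jointYZ p q) = margB p := by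
  funext y
  simp only [margA, jointYZ, ← Finset.mul_sum, hq.2, mul_one]

theorem jointXZ_nonneg [Fintype α] [Fintype β] [Fintype γ] {p : α × β → ℝ}
    (hp : ∀ x, 0 ≤ p x) {q : β → γ → ℝ} (hq : IsChannel q) (x : α × γ) : 0 ≤ jointXZ p q x :=
  Finset.sum_nonneg fun y _ => mul_nonneg (hp _) (hq.1 y _)

theorem jointYZ_nonneg [Fintype α] [Fintype β] [Fintype γ] {p : α × β → ℝ}
    (hp : ∀ x, 0 ≤ p x) {q : β → γ → ℝ} (hq : IsChannel q) (x : β × γ) : 0 ≤ jointYZ p q x :=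
  mul_nonneg (Finset.sum_nonneg fun _ _ => hp _) (hq.1 _ _)

/-- Time sharing: use the channel `q` with weight `c` and the channel `q'` with weight `d`,
and reveal which one was used. -/
def timeShare {m n : ℕ} (c d : ℝ) (q : β → Fin m → ℝ) (q' : β → Fin n → ℝ) :
    β → Fin (m + n) → ℝ :=
  fun y => Fin.addCases (fun i => c * q y i) (fun j => d * q' y j)

theorem IsChannel.timeShare {m n : ℕ} {c d : ℝ} (hc : 0 ≤ c) (hd : 0 ≤ d) (hcd : c + d = 1)
    {q : β → Fin m → ℝ} {q' : β → Fin n → ℝ} (hq : IsChannel q) (hq' : IsChannel q') :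
    IsChannel (timeShare c d q q') := by
  refine ⟨fun y z => ?_, fun y => ?_⟩
  · refine Fin.addCases (fun i => ?_) (fun j => ?_) z
    · simpa [RatePrivacy.timeShare] using mul_nonneg hc (hq.1 y i)
    · simpa [RatePrivacy.timeShare] using mul_nonneg hd (hq'.1 y j)
  · simp [RatePrivacy.timeShare, Fin.sum_univ_add, ← Finset.mul_sum, hq.2, hq'.2, hcd]

theorem mi_jointXZ_timeShare [Fintype α] [Fintype β] {p : α × β → ℝ} (hp : ∀ x, 0 ≤ p x)
    {m n : ℕ} {c d : ℝ} (hc : 0 ≤ c) (hd : 0 ≤ d) (hcd : c + d = 1)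
    {q : β → Fin m → ℝ} {q' : β → Fin n → ℝ} (hq : IsChannel q) (hq' : IsChannel q') :
    mi (jointXZ p (timeShare c d q q')) = c * mi (jointXZ p q) + d * mi (jointXZ p q') := by
  have hl : (fun x : α × Fin m => jointXZ p (timeShare c d q q') (x.1, Fin.castAdd n x.2)) =
      fun x => c * jointXZ p q x := by
    funext x
    simp only [jointXZ, timeShare, Fin.addCases_left, Finset.mul_sum]
    exact Finset.sum_congr rfl fun y _ => by ring
  have hr : (fun x : α × Fin n => jointXZ p (timeShare c d q q') (x.1, Fin.natAdd m x.2)) =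
      fun x => d * jointXZ p q' x := by
    funext x
    simp only [jointXZ, timeShare, Fin.addCases_right, Finset.mul_sum]
    exact Finset.sum_congr rfl fun y _ => by ring
  simp only [mi_eq_add_negCondEnt]
  rw [margA_jointXZ p (hq.timeShare hc hd hcd hq'), margA_jointXZ p hq, margA_jointXZ p hq',
    negCondEnt_fin_add, hl, hr, negCondEnt_smul _ (jointXZ_nonneg hp hq),
    negCondEnt_smul _ (jointXZ_nonneg hp hq')]
  linear_combination -ent (margA p) * hcd

theorem mi_jointYZ_timeShare [Fintype α] [Fintype β] {p : α × β → ℝ} (hp : ∀ x, 0 ≤ p x)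
    {m n : ℕ} {c d : ℝ} (hc : 0 ≤ c) (hd : 0 ≤ d) (hcd : c + d = 1)
    {q : β → Fin m → ℝ} {q' : β → Fin n → ℝ} (hq : IsChannel q) (hq' : IsChannel q') :
    mi (jointYZ p (timeShare c d q q')) = c * mi (jointYZ p q) + d * mi (jointYZ p q') := by
  have hl : (fun x : β × Fin m => jointYZ p (timeShare c d q q') (x.1, Fin.castAdd n x.2)) =
      fun x => c * jointYZ p q x := by
    funext x
    simp only [jointYZ, timeShare, Fin.addCases_left]
    ring
  have hr : (fun x : β × Fin n => jointYZ p (timeShare c d q q') (x.1, Fin.natAdd m x.2)) =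
      fun x => d * jointYZ p q' x := by
    funext x
    simp only [jointYZ, timeShare, Fin.addCases_right]
    ring
  simp only [mi_eq_add_negCondEnt]
  rw [margA_jointYZ p (hq.timeShare hc hd hcd hq'), margA_jointYZ p hq, margA_jointYZ p hq',
    negCondEnt_fin_add, hl, hr, negCondEnt_smul _ (jointYZ_nonneg hp hq),
    negCondEnt_smul _ (jointYZ_nonneg hp hq')]
  linear_combination -ent (margB p) * hcd

theorem bddAbove_gSet [Fintype α] [Fintype β] {p : α × β → ℝ} (hp : ∀ x, 0 ≤ p x) (ε : ℝ) :
    BddAbove (gSet p ε) := by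
  refine ⟨ent (margB p), ?_⟩
  rintro r ⟨n, q, hq, -, rfl⟩
  rw [mi_eq_add_negCondEnt, margA_jointYZ p hq]
  linarith [negCondEnt_nonpos _ (jointYZ_nonneg hp hq)]

theorem gSet_nonempty [Fintype α] [Fintype β] {p : α × β → ℝ} (hp : IsPMF p) {ε : ℝ}
    (hε : 0 ≤ ε) : (gSet p ε).Nonempty := by
  refine ⟨_, 1, fun _ _ => 1, ⟨fun _ _ => zero_le_one, fun _ => by simp⟩, ?_, rfl⟩
  have hsum : ∑ x, ∑ y, p (x, y) = 1 := by rw [← Fintype.sum_prod_type]; exact hp.2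
  have hmi : mi (jointXZ p fun (_ : β) (_ : Fin 1) => 1) = 0 := by
    simp [mi, ent, margA, margB, jointXZ, Fintype.sum_prod_type, hsum]
  exact hmi.trans_le hε

theorem mul_sSup_add_mul_sSup_le {A B : Set ℝ} (hA : A.Nonempty) (hB : B.Nonempty) {c d s : ℝ}
    (hc : 0 < c) (hd : 0 < d) (h : ∀ a ∈ A, ∀ b ∈ B, c * a + d * b ≤ s) :
    c * sSup A + d * sSup B ≤ s := by
  have hB' : ∀ a ∈ A, sSup B ≤ (s - c * a) / d := fun a ha =>
    csSup_le hB fun b hb => (le_div_iff₀ hd).2 (by linarith [h a ha b hb])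
  have hA' : sSup A ≤ (s - d * sSup B) / c := csSup_le hA fun a ha => by
    have := (le_div_iff₀ hd).1 (hB' a ha)
    exact (le_div_iff₀ hc).2 (by linarith)
  have := (le_div_iff₀ hc).1 hA'
  linarith

/-- The map `ε ↦ g_ε(X;Y)` is concave on `[0,∞)`: for all
`0 ≤ ε₁ < ε₂ < ε₃`,
`g_{ε₂} ≥ ((ε₂−ε₁)/(ε₃−ε₁))·g_{ε₃} + ((ε₃−ε₂)/(ε₃−ε₁))·g_{ε₁}`. -/
theorem stmt1 {𝓧 𝓨 : Type*} [Fintype 𝓧] [Fintype 𝓨]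
    (p : 𝓧 × 𝓨 → ℝ) (hp : IsPMF p) :
    ∀ ε₁ ε₂ ε₃ : ℝ, 0 ≤ ε₁ → ε₁ < ε₂ → ε₂ < ε₃ →
      ((ε₂ - ε₁) / (ε₃ - ε₁)) * g p ε₃ + ((ε₃ - ε₂) / (ε₃ - ε₁)) * g p ε₁ ≤ g p ε₂ := by
  intro ε₁ ε₂ ε₃ h₁ h₁₂ h₂₃
  have h₁₃ : 0 < ε₃ - ε₁ := by linarith
  have hc : 0 < (ε₂ - ε₁) / (ε₃ - ε₁) := div_pos (by linarith) h₁₃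
  have hd : 0 < (ε₃ - ε₂) / (ε₃ - ε₁) := div_pos (by linarith) h₁₃
  have hcd : (ε₂ - ε₁) / (ε₃ - ε₁) + (ε₃ - ε₂) / (ε₃ - ε₁) = 1 := by
    field_simp
    ring
  have hε : (ε₂ - ε₁) / (ε₃ - ε₁) * ε₃ + (ε₃ - ε₂) / (ε₃ - ε₁) * ε₁ = ε₂ := by
    field_simp
    ring
  refine mul_sSup_add_mul_sSup_le (gSet_nonempty hp (by linarith)) (gSet_nonempty hp h₁) hc hd ?_
  rintro _ ⟨m, q, hq, hmi, rfl⟩ _ ⟨n, q', hq', hmi', rfl⟩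
  refine le_csSup (bddAbove_gSet hp.1 ε₂) ⟨m + n, _, hq.timeShare hc.le hd.le hcd hq', ?_,
    (mi_jointYZ_timeShare hp.1 hc.le hd.le hcd hq hq').symm⟩
  rw [mi_jointXZ_timeShare hp.1 hc.le hd.le hcd hq hq']
  have h₃ := mul_le_mul_of_nonneg_left hmi hc.le
  have h₄ := mul_le_mul_of_nonneg_left hmi' hd.le
  linarith

end RatePrivacy
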